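/- Let $\theta \in (0, \pi/4)$ and set $m = \lceil \tfrac{1}{2}(\tfrac{\pi}{4\theta} - 1) \rceil$. Then $\pi/4 \leq (2m+1)\theta \leq 3\pi/4$, and consequently $\sin^2((2m+1)\theta) \geq 1/2$. -/

import Mathlib

open Real

theorem half_le_sin_sq {x : ℝ} (h₁ : π / 4 ≤ x) (h₂ : x ≤ 3 * π / 4) :
    1 / 2 ≤ Real.sin x ^ 2 := by
  have hcos : Real.cos (2 * x) ≤ 0 :=
    Real.cos_nonpos_of_pi_div_two_le_of_le (by linarith) (by linarith)
  rw [Real.sin_sq_eq_half_sub]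
  linarith

theorem stmt_2 (θ : ℝ) (hθ0 : 0 < θ) (hθ1 : θ < π / 4)
    (m : ℕ) (hm : m = ⌈(1 / 2 : ℝ) * (π / (4 * θ) - 1)⌉₊) :
    π / 4 ≤ (2 * (m : ℝ) + 1) * θ ∧ (2 * (m : ℝ) + 1) * θ ≤ 3 * π / 4 ∧
      1 / 2 ≤ Real.sin ((2 * (m : ℝ) + 1) * θ) ^ 2 := by
  have hmul : π / (4 * θ) * θ = π / 4 := by field_simp
  have hone : 1 ≤ π / (4 * θ) := by
    rw [le_div_iff₀ (by positivity)]
    linarith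
  have hle := Nat.le_ceil ((1 / 2 : ℝ) * (π / (4 * θ) - 1))
  have hlt := Nat.ceil_lt_add_one (a := (1 / 2 : ℝ) * (π / (4 * θ) - 1)) (by linarith)
  rw [← hm] at hle hlt
  have lower : π / 4 ≤ (2 * (m : ℝ) + 1) * θ := by
    rw [← hmul]
    gcongr
    linarith
  have upper : (2 * (m : ℝ) + 1) * θ ≤ 3 * π / 4 := by
    calc (2 * (m : ℝ) + 1) * θ ≤ (π / (4 * θ) + 2) * θ :=
          mul_le_mul_of_nonneg_right (by linarith) hθ0.le
      _ = π / 4 + 2 * θ := by rw [add_mul, hmul]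
      _ ≤ 3 * π / 4 := by linarith
  exact ⟨lower, upper, half_le_sin_sq lower upper⟩
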